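/- arXiv:1309.0437 — 2 statements merged into one kernel-verified Lean document; each statement's English description precedes it below -/
import Mathlib

section
/- For real t > 0, the star product of polynomials f, g ∈ ℂ[t,q,p] satisfies the Gaussian integral formula: (f ⋆ g)(t,q,p) = (1/(2πi t)) ∫_ℂ f(t,q,p+z̄)·g(t,q+z,p)·e^{-|z|²/t} dz̄∧dz. -/
open Finset MeasureTheory

/-- The Moyal normal-order star product on `ℂ[t,q,p]` in coefficient form:
`f i j l` is the coefficient of `q^i p^j t^l`. -/
noncomputable def starP (f g : ℕ → ℕ → ℕ → ℂ) : ℕ → ℕ → ℕ → ℂ := fun i j l =>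
  ∑ k ∈ range (l + 1), ∑ n ∈ range (l - k + 1), ∑ i1 ∈ range (i + 1), ∑ j1 ∈ range (j + 1),
    (1 / (k.factorial : ℂ)) *
      (((j1 + k).factorial : ℂ) / (j1.factorial : ℂ)) * f i1 (j1 + k) n *
      ((((i - i1) + k).factorial : ℂ) / ((i - i1).factorial : ℂ)) * g ((i - i1) + k) (j - j1) (l - k - n)

/-- Evaluation of a (finitely supported) coefficient family at `(t,q,p)`. -/
noncomputable def evalP (f : ℕ → ℕ → ℕ → ℂ) (t q p : ℂ) : ℂ :=
  ∑' i : ℕ, ∑' j : ℕ, ∑' k : ℕ, f i j k * q ^ i * p ^ j * t ^ k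

theorem diag_sum (M : ℕ) (u : ℕ → ℕ → ℂ) (hu : ∀ a b, M ≤ a + b → u a b = 0) :
    ∑ i ∈ range M, ∑ a ∈ range (i + 1), u a (i - a) =
      ∑ a ∈ range M, ∑ b ∈ range M, u a b := by
  rw [Finset.sum_range_diag_flip M u]
  refine Finset.sum_congr rfl fun a _ => ?_
  refine Finset.sum_subset (by intro x; simp; omega) fun b _ hb => hu a b ?_
  simp at hb; omega

theorem evalP_box (M : ℕ) (f : ℕ → ℕ → ℕ → ℂ)
    (h : ∀ i j k, M ≤ i ∨ M ≤ j ∨ M ≤ k → f i j k = 0) (t q p : ℂ) :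
    evalP f t q p =
      ∑ i ∈ range M, ∑ j ∈ range M, ∑ k ∈ range M, f i j k * q ^ i * p ^ j * t ^ k := by
  unfold evalP
  rw [tsum_eq_sum (s := range M)]
  · refine Finset.sum_congr rfl fun i _ => ?_
    rw [tsum_eq_sum (s := range M)]
    · refine Finset.sum_congr rfl fun j _ => ?_
      rw [tsum_eq_sum (s := range M)]
      intro k hk
      rw [h i j k (by simp at hk; omega)]; simp
    · intro j hj
      simp at hj
      simp [show ∀ k, f i j k = 0 from fun k => h i j k (by omega)]
  · intro i hi
    simp at hi
    simp [show ∀ j k, f i j k = 0 from fun j k => h i j k (by omega)]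

theorem moment_abs (t : ℝ) (ht : 0 < t) (n : ℕ) :
    ∫ z : ℂ, ‖z‖ ^ n * Real.exp (-‖z‖ ^ 2 / t) =
      Real.pi * t ^ (((n : ℝ) + 2) / 2) * Real.Gamma (((n : ℝ) + 2) / 2) := by
  have h := Complex.integral_rpow_mul_exp_neg_mul_rpow (p := 2) (q := n) (b := 1 / t)
    (by norm_num) (by have : (0 : ℝ) ≤ n := by positivity
                      linarith) (by positivity)
  have e : ∀ z : ℂ, ‖z‖ ^ (n : ℝ) * Real.exp (-(1 / t) * ‖z‖ ^ (2 : ℝ)) =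
      ‖z‖ ^ n * Real.exp (-‖z‖ ^ 2 / t) := by
    intro z
    rw [Real.rpow_natCast, Real.rpow_two]
    congr 2; ring
  simp_rw [e] at h
  rw [h, one_div, Real.inv_rpow ht.le, neg_div, Real.rpow_neg ht.le, inv_inv]
  ring

theorem moment_integrable (t : ℝ) (ht : 0 < t) (k l : ℕ) :
    Integrable (fun z : ℂ => (starRingEnd ℂ z) ^ k * z ^ l *
      Complex.exp (((-‖z‖ ^ 2 / t : ℝ) : ℂ))) := by
  have h : Integrable (fun z : ℂ => ‖z‖ ^ (k + l) * Real.exp (-‖z‖ ^ 2 / t)) := by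
    apply Integrable.of_integral_ne_zero
    rw [moment_abs t ht]
    have := Real.Gamma_pos_of_pos (s := (((k + l : ℕ) : ℝ) + 2) / 2) (by positivity)
    have := Real.pi_pos
    positivity
  refine h.mono (by
    apply Continuous.aestronglyMeasurable
    have := Complex.continuous_conj
    fun_prop) ?_
  refine Filter.Eventually.of_forall fun z => ?_
  rw [← Complex.ofReal_exp, norm_mul, norm_mul, norm_pow, norm_pow, Complex.norm_real,
    RCLike.norm_conj, norm_mul, norm_pow, norm_norm, pow_add]

theorem moment_diag (t : ℝ) (ht : 0 < t) (k : ℕ) :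
    ∫ z : ℂ, (starRingEnd ℂ z) ^ k * z ^ k * Complex.exp (((-‖z‖ ^ 2 / t : ℝ) : ℂ)) =
      Real.pi * k.factorial * t ^ (k + 1) := by
  have h := moment_abs t ht (2 * k)
  have e1 : (((2 * k : ℕ) : ℝ) + 2) / 2 = ((k + 1 : ℕ) : ℝ) := by push_cast; ring
  rw [e1, Real.rpow_natCast] at h
  push_cast at h
  rw [Real.Gamma_nat_eq_factorial] at h
  have e : ∀ z : ℂ, (starRingEnd ℂ z) ^ k * z ^ k * Complex.exp (((-‖z‖ ^ 2 / t : ℝ) : ℂ)) =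
      ((‖z‖ ^ (2 * k) * Real.exp (-‖z‖ ^ 2 / t) : ℝ) : ℂ) := by
    intro z
    rw [← mul_pow, mul_comm _ z, Complex.mul_conj, Complex.normSq_eq_norm_sq]
    push_cast
    rw [pow_mul]
  simp_rw [e]
  rw [integral_complex_ofReal, h]
  push_cast; ring

theorem moment_off (t : ℝ) (k l : ℕ) (hkl : k ≠ l) :
    ∫ z : ℂ, (starRingEnd ℂ z) ^ k * z ^ l * Complex.exp (((-‖z‖ ^ 2 / t : ℝ) : ℂ)) = 0 := by
  have hne : (l : ℝ) - k ≠ 0 := sub_ne_zero.mpr (by exact_mod_cast hkl.symm)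
  set F : ℂ → ℂ := fun z =>
    (starRingEnd ℂ z) ^ k * z ^ l * Complex.exp (((-‖z‖ ^ 2 / t : ℝ) : ℂ)) with hF
  set c : Circle := Circle.exp (Real.pi / ((l : ℝ) - k)) with hc
  have hmp := (rotation c).measurePreserving
  have h1 : ∫ z : ℂ, F (rotation c z) = ∫ z : ℂ, F z :=
    hmp.integral_comp (rotation c).toHomeomorph.measurableEmbedding F
  have hcc : (starRingEnd ℂ (c : ℂ)) ^ k * (c : ℂ) ^ l = -1 := by
    rw [hc, Circle.coe_exp, ← Complex.exp_conj, ← Complex.exp_nat_mul, ← Complex.exp_nat_mul,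
      ← Complex.exp_add, ← Complex.exp_pi_mul_I]
    congr 1
    have hne' : (l : ℂ) - k ≠ 0 := by exact_mod_cast hne
    simp
    field_simp
    ring
  have h2 : ∀ z, F (rotation c z) = - F z := by
    intro z
    simp only [hF, rotation_apply, map_mul, norm_mul, Circle.norm_coe, one_mul, mul_pow]
    linear_combination (starRingEnd ℂ z) ^ k * z ^ l *
      Complex.exp (((-‖z‖ ^ 2 / t : ℝ) : ℂ)) * hcc
  simp_rw [h2] at h1
  rw [integral_neg] at h1
  change ∫ z, F z = 0
  linear_combination (-1 / 2 : ℂ) * h1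

/-- `k`-th Taylor coefficient of `f` in `p`. -/
noncomputable def coefA (M : ℕ) (f : ℕ → ℕ → ℕ → ℂ) (t q p : ℂ) (k : ℕ) : ℂ :=
  ∑ a ∈ range M, ∑ c ∈ range M, ∑ b ∈ range M,
    f a (b + k) c * ((b + k).choose k : ℂ) * q ^ a * p ^ b * t ^ c

theorem evalP_expand (M : ℕ) (f : ℕ → ℕ → ℕ → ℂ)
    (h : ∀ i j k, M ≤ i ∨ M ≤ j ∨ M ≤ k → f i j k = 0) (t q p w : ℂ) :
    evalP f t q (p + w) = ∑ k ∈ range M, coefA M f t q p k * w ^ k := by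
  rw [evalP_box M f h]
  simp_rw [coefA, Finset.sum_mul]
  rw [Finset.sum_comm (s := range M) (t := range M)
    (f := fun k a => ∑ c ∈ range M, ∑ b ∈ range M,
      f a (b + k) c * ((b + k).choose k : ℂ) * q ^ a * p ^ b * t ^ c * w ^ k)]
  refine Finset.sum_congr rfl fun a _ => ?_
  rw [Finset.sum_comm, Finset.sum_comm (s := range M) (t := range M)
    (f := fun k c => ∑ b ∈ range M,
      f a (b + k) c * ((b + k).choose k : ℂ) * q ^ a * p ^ b * t ^ c * w ^ k)]
  refine Finset.sum_congr rfl fun c _ => ?_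
  rw [← diag_sum M (fun k b => f a (b + k) c * ((b + k).choose k : ℂ) * q ^ a * p ^ b * t ^ c * w ^ k)]
  · refine Finset.sum_congr rfl fun b _ => ?_
    rw [add_comm p w, add_pow, Finset.mul_sum, Finset.sum_mul]
    refine Finset.sum_congr rfl fun k hk => ?_
    have : b - k + k = b := by simp at hk; omega
    rw [this]; ring
  · intro k b hkb
    rw [h _ _ _ (by omega)]; simp

theorem evalP_swap (M : ℕ) (g : ℕ → ℕ → ℕ → ℂ)
    (h : ∀ i j k, M ≤ i ∨ M ≤ j ∨ M ≤ k → g i j k = 0) (t q p : ℂ) :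
    evalP g t q p = evalP (fun j i k => g i j k) t p q := by
  rw [evalP_box M g h, evalP_box M _ (fun i j k hh => h j i k (by omega)), Finset.sum_comm]
  refine Finset.sum_congr rfl fun a _ => Finset.sum_congr rfl fun b _ =>
    Finset.sum_congr rfl fun c _ => by ring

theorem starP_vanish (M : ℕ) (f g : ℕ → ℕ → ℕ → ℂ)
    (h : ∀ a b c a' b' c' k, M ≤ a + a' ∨ M ≤ b + b' ∨ M ≤ c + c' + k →
      f a (b + k) c * g (a' + k) b' c' = 0) (i j l : ℕ) (hM : M ≤ i ∨ M ≤ j ∨ M ≤ l) :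
    starP f g i j l = 0 := by
  unfold starP
  refine Finset.sum_eq_zero fun k hk => Finset.sum_eq_zero fun n hn =>
    Finset.sum_eq_zero fun i1 hi => Finset.sum_eq_zero fun j1 hj => ?_
  simp at hk hn hi hj
  have := h i1 j1 n (i - i1) (j - j1) (l - k - n) k (by omega)
  rw [mul_right_comm _ (f i1 (j1 + k) n), mul_assoc, this, mul_zero]

theorem star_eval (M : ℕ) (f g : ℕ → ℕ → ℕ → ℂ)
    (h : ∀ a b c a' b' c' k, M ≤ a + a' ∨ M ≤ b + b' ∨ M ≤ c + c' + k →
      f a (b + k) c * g (a' + k) b' c' = 0) (t q p : ℂ) :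
    evalP (starP f g) t q p = ∑ k ∈ range M, k.factorial * t ^ k *
      (coefA M f t q p k * coefA M (fun j i k => g i j k) t p q k) := by
  rw [evalP_box M _ (starP_vanish M f g h)]
  set T : ℕ → ℕ → ℕ → ℕ → ℕ → ℕ → ℕ → ℂ := fun k c c' a a' b b' =>
    (1 / (k.factorial : ℂ)) *
      (((b + k).factorial : ℂ) / (b.factorial : ℂ)) * f a (b + k) c *
      (((a' + k).factorial : ℂ) / (a'.factorial : ℂ)) * g (a' + k) b' c' *
      q ^ (a + a') * p ^ (b + b') * t ^ (c + c' + k) with hT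
  have hT0 : ∀ a b c a' b' c' k, M ≤ a + a' ∨ M ≤ b + b' ∨ M ≤ c + c' + k →
      T k c c' a a' b b' = 0 := by
    intro a b c a' b' c' k hh
    have := h a b c a' b' c' k hh
    simp only [hT]
    linear_combination (1 / (k.factorial : ℂ)) *
      (((b + k).factorial : ℂ) / (b.factorial : ℂ)) *
      (((a' + k).factorial : ℂ) / (a'.factorial : ℂ)) *
      q ^ (a + a') * p ^ (b + b') * t ^ (c + c' + k) * this
  have e1 : ∑ i ∈ range M, ∑ j ∈ range M, ∑ l ∈ range M,
      starP f g i j l * q ^ i * p ^ j * t ^ l =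
    ∑ l ∈ range M, ∑ k ∈ range (l + 1), ∑ n ∈ range (l - k + 1),
      ∑ i ∈ range M, ∑ i1 ∈ range (i + 1), ∑ j ∈ range M, ∑ j1 ∈ range (j + 1),
        T k n (l - k - n) i1 (i - i1) j1 (j - j1) := by
    have : ∀ i j l, starP f g i j l * q ^ i * p ^ j * t ^ l =
        ∑ k ∈ range (l + 1), ∑ n ∈ range (l - k + 1), ∑ i1 ∈ range (i + 1),
          ∑ j1 ∈ range (j + 1), T k n (l - k - n) i1 (i - i1) j1 (j - j1) := by
      intro i j l
      simp only [starP, Finset.sum_mul]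
      refine Finset.sum_congr rfl fun k hk => Finset.sum_congr rfl fun n hn =>
        Finset.sum_congr rfl fun i1 hi => Finset.sum_congr rfl fun j1 hj => ?_
      simp at hk hn hi hj
      simp only [hT]
      rw [show i1 + (i - i1) = i by omega, show j1 + (j - j1) = j by omega,
        show n + (l - k - n) + k = l by omega]
    simp_rw [this]
    calc _ = ∑ i ∈ range M, ∑ l ∈ range M, ∑ j ∈ range M, _ :=
          Finset.sum_congr rfl fun i _ => Finset.sum_comm
      _ = ∑ l ∈ range M, ∑ i ∈ range M, ∑ j ∈ range M, _ := Finset.sum_comm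
      _ = _ := ?_
    refine Finset.sum_congr rfl fun l _ => ?_
    calc _ = ∑ i ∈ range M, ∑ k ∈ range (l + 1), ∑ j ∈ range M, _ :=
          Finset.sum_congr rfl fun i _ => Finset.sum_comm
      _ = ∑ k ∈ range (l + 1), ∑ i ∈ range M, ∑ j ∈ range M, _ := Finset.sum_comm
      _ = _ := ?_
    refine Finset.sum_congr rfl fun k _ => ?_
    calc _ = ∑ i ∈ range M, ∑ n ∈ range (l - k + 1), ∑ j ∈ range M, _ :=
          Finset.sum_congr rfl fun i _ => Finset.sum_comm
      _ = ∑ n ∈ range (l - k + 1), ∑ i ∈ range M, ∑ j ∈ range M, _ := Finset.sum_comm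
      _ = _ := ?_
    refine Finset.sum_congr rfl fun n _ => Finset.sum_congr rfl fun i _ => Finset.sum_comm
  have e2 : ∀ k c c', (∑ i ∈ range M, ∑ i1 ∈ range (i + 1), ∑ j ∈ range M, ∑ j1 ∈ range (j + 1),
        T k c c' i1 (i - i1) j1 (j - j1)) =
      ∑ a ∈ range M, ∑ a' ∈ range M, ∑ b ∈ range M, ∑ b' ∈ range M, T k c c' a a' b b' := by
    intro k c c'
    rw [diag_sum M (fun a a' => ∑ j ∈ range M, ∑ j1 ∈ range (j + 1), T k c c' a a' j1 (j - j1))]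
    · refine Finset.sum_congr rfl fun a _ => Finset.sum_congr rfl fun a' _ => ?_
      exact diag_sum M (fun b b' => T k c c' a a' b b') fun b b' hb => hT0 _ _ _ _ _ _ _ (by omega)
    · intro a a' ha
      exact Finset.sum_eq_zero fun _ _ => Finset.sum_eq_zero fun _ _ =>
        hT0 _ _ _ _ _ _ _ (by omega)
  rw [e1]
  simp_rw [e2]
  set S : ℕ → ℕ → ℕ → ℂ := fun k c c' =>
    ∑ a ∈ range M, ∑ a' ∈ range M, ∑ b ∈ range M, ∑ b' ∈ range M, T k c c' a a' b b' with hS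
  have hS0 : ∀ k c c', M ≤ c + c' + k → S k c c' = 0 := fun k c c' hh =>
    Finset.sum_eq_zero fun _ _ => Finset.sum_eq_zero fun _ _ =>
      Finset.sum_eq_zero fun _ _ => Finset.sum_eq_zero fun _ _ =>
        hT0 _ _ _ _ _ _ _ (by omega)
  change ∑ l ∈ range M, ∑ k ∈ range (l + 1), ∑ n ∈ range (l - k + 1), S k n (l - k - n) = _
  rw [diag_sum M (fun k m => ∑ n ∈ range (m + 1), S k n (m - n))]
  · refine Finset.sum_congr rfl fun k _ => ?_
    rw [diag_sum M (fun c c' => S k c c') fun c c' hh => hS0 _ _ _ (by omega)]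
    have hch : ∀ b : ℕ, (((b + k).choose k : ℕ) : ℂ) =
        ((b + k).factorial : ℂ) / (b.factorial : ℂ) / (k.factorial : ℂ) := by
      intro b
      have h1 := Nat.add_choose_mul_factorial_mul_factorial b k
      have h2 : (((b + k).choose k : ℕ) : ℂ) * b.factorial * k.factorial = (b + k).factorial := by
        exact_mod_cast h1
      have h3 : (b.factorial : ℂ) ≠ 0 := by exact_mod_cast b.factorial_ne_zero
      have h4 : (k.factorial : ℂ) ≠ 0 := by exact_mod_cast k.factorial_ne_zero
      rw [← h2]
      field_simp
    have hA : coefA M f t q p k = ∑ c ∈ range M, ∑ a ∈ range M, ∑ b ∈ range M,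
        f a (b + k) c * ((b + k).choose k : ℂ) * q ^ a * p ^ b * t ^ c := Finset.sum_comm
    have hB : coefA M (fun j i k => g i j k) t p q k =
        ∑ c ∈ range M, ∑ a ∈ range M, ∑ b ∈ range M,
        g (a + k) b c * ((a + k).choose k : ℂ) * p ^ b * q ^ a * t ^ c :=
      Finset.sum_comm.trans (Finset.sum_congr rfl fun c _ => Finset.sum_comm)
    rw [hA, hB]
    simp only [Finset.sum_mul_sum]
    simp only [Finset.mul_sum, hS]
    refine Finset.sum_congr rfl fun c _ => Finset.sum_congr rfl fun c' _ =>
      Finset.sum_congr rfl fun a _ => Finset.sum_congr rfl fun a' _ =>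
      Finset.sum_congr rfl fun b _ => Finset.sum_congr rfl fun b' _ => ?_
    have h4 : (k.factorial : ℂ) ≠ 0 := by exact_mod_cast k.factorial_ne_zero
    have h5 : (k.factorial : ℂ) * (k.factorial : ℂ)⁻¹ = 1 := mul_inv_cancel₀ h4
    simp only [hT, hch, pow_add, div_eq_mul_inv, one_mul]
    set x := (k.factorial : ℂ)⁻¹
    linear_combination (-(x * ((b + k).factorial : ℂ) * (b.factorial : ℂ)⁻¹ * f a (b + k) c *
      ((a' + k).factorial : ℂ) * (a'.factorial : ℂ)⁻¹ * g (a' + k) b' c' *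
      (q ^ a * q ^ a') * (p ^ b * p ^ b') * (t ^ c * t ^ c' * t ^ k))) * h5
  · intro k m hm
    refine Finset.sum_eq_zero fun n hn => hS0 _ _ _ ?_
    simp at hn; omega

/-- Gaussian-integral (thimble) formula for the star product of
polynomials: for real `t > 0`,
`(f ⋆ g)(t,q,p) = (1/(2πi t)) ∫_ℂ f(t,q,p+z̄) g(t,q+z,p) e^{-|z|²/t} dz̄∧dz`,
where `dz̄∧dz = 2i dx∧dy`. -/
theorem star_integral_formula (f g : ℕ → ℕ → ℕ → ℂ)
    (hf : ∃ N, ∀ i j k, N ≤ i + j + k → f i j k = 0)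
    (hg : ∃ N, ∀ i j k, N ≤ i + j + k → g i j k = 0)
    (t : ℝ) (ht : 0 < t) (q p : ℂ) :
    evalP (starP f g) t q p =
      (1 / (2 * Real.pi * Complex.I * t)) *
        ((2 * Complex.I) * ∫ z : ℂ,
          evalP f t q (p + (starRingEnd ℂ) z) * evalP g t (q + z) p *
            Complex.exp (((-‖z‖ ^ 2 / t : ℝ) : ℂ))) := by
  obtain ⟨N1, hf⟩ := hf
  obtain ⟨N2, hg⟩ := hg
  set M := N1 + N2 with hM
  have hf' : ∀ i j k, M ≤ i ∨ M ≤ j ∨ M ≤ k → f i j k = 0 := fun i j k h => hf _ _ _ (by omega)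
  have hg' : ∀ i j k, M ≤ i ∨ M ≤ j ∨ M ≤ k → g i j k = 0 := fun i j k h => hg _ _ _ (by omega)
  rw [star_eval M f g]
  · have e : ∀ z : ℂ, evalP f t q (p + (starRingEnd ℂ) z) * evalP g t (q + z) p *
            Complex.exp (((-‖z‖ ^ 2 / t : ℝ) : ℂ)) =
        ∑ k ∈ range M, ∑ l ∈ range M,
          (coefA M f t q p k * coefA M (fun j i k => g i j k) t p q l) *
          ((starRingEnd ℂ z) ^ k * z ^ l * Complex.exp (((-‖z‖ ^ 2 / t : ℝ) : ℂ))) := by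
      intro z
      rw [evalP_expand M f hf', evalP_swap M g hg',
        evalP_expand M _ (fun i j k hh => hg' j i k (by omega)), Finset.sum_mul_sum,
        Finset.sum_mul]
      refine Finset.sum_congr rfl fun k _ => ?_
      rw [Finset.sum_mul]
      refine Finset.sum_congr rfl fun l _ => ?_
      ring
    simp_rw [e]
    rw [integral_finsetSum _ fun k _ => integrable_finsetSum _ fun l _ =>
      (moment_integrable t ht k l).const_mul _]
    simp_rw [Finset.mul_sum]
    refine Finset.sum_congr rfl fun k hk => ?_
    rw [integral_finsetSum _ fun l _ => (moment_integrable t ht k l).const_mul _,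
      Finset.sum_eq_single k]
    · rw [integral_const_mul, moment_diag t ht]
      have h1 : (t : ℂ) ≠ 0 := by exact_mod_cast ht.ne'
      have h2 : (Real.pi : ℂ) ≠ 0 := by exact_mod_cast Real.pi_ne_zero
      have h3 := Complex.I_ne_zero
      field_simp
      ring
    · intro l _ hl
      rw [integral_const_mul, moment_off t k l hl.symm, mul_zero]
    · intro h; exact absurd hk h
  · intro a b c a' b' c' k hh
    by_cases h1 : N1 ≤ a + (b + k) + c
    · rw [hf _ _ _ h1, zero_mul]
    · rw [hg _ _ _ (by omega), mul_zero]
end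

section
/- If f, g ∈ ℂ{ξ} are germs at 0 of holomorphic functions, each extending holomorphically to ℂ∖Σ_f and ℂ∖Σ_g respectively (analytic continuation along every path avoiding the finite sets Σ_f, Σ_g ⊂ ℂ∖{0}), then the additive convolution (f ⊕ g)(ξ) = ∫_0^ξ f(t)g(ξ−t)dt extends analytically along every path starting at 0 that avoids the finite set Σ_f ∪ Σ_g ∪ (Σ_f + Σ_g). -/
open Pointwise intervalIntegral Filter

/-- Analytic continuation of a germ (represented by a function `h` holomorphic
near `γ 0`) along a path `γ : [0,1] → ℂ`: a family of local holomorphic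
representatives `F s` on open sets `U s ∋ γ s`, locally consistent in `s`,
starting from the germ of `h` at `γ 0`. -/
def AnalyticContinuationAlong (h : ℂ → ℂ) (γ : ℝ → ℂ) : Prop :=
  ∃ (U : ℝ → Set ℂ) (F : ℝ → ℂ → ℂ),
    (∀ s ∈ Set.Icc (0 : ℝ) 1, IsOpen (U s) ∧ γ s ∈ U s ∧ DifferentiableOn ℂ (F s) (U s)) ∧
    (∀ s ∈ Set.Icc (0 : ℝ) 1, ∃ ε > (0 : ℝ), ∀ s' ∈ Set.Icc (0 : ℝ) 1, |s' - s| < ε →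
      γ s' ∈ U s ∧ ∀ᶠ z in nhds (γ s'), F s' z = F s z) ∧
    (∀ᶠ z in nhds (γ 0), F 0 z = h z)

open Set Metric Topology in
theorem param_hasDerivAt {φ φ' : ℂ → ℝ → ℂ} {K : Set ℂ} (hK : IsCompact K) {x : ℂ}
    (hKn : K ∈ 𝓝 x)
    (c1 : ContinuousOn (fun p : ℂ × ℝ => φ p.1 p.2) (K ×ˢ Icc (0 : ℝ) 1))
    (c2 : ContinuousOn (fun p : ℂ × ℝ => φ' p.1 p.2) (K ×ˢ Icc (0 : ℝ) 1))
    (hd : ∀ y ∈ K, ∀ u ∈ Icc (0 : ℝ) 1, HasDerivAt (fun y => φ y u) (φ' y u) y) :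
    IntervalIntegrable (φ' x) MeasureTheory.volume 0 1 ∧
    HasDerivAt (fun x => ∫ u in (0 : ℝ)..1, φ x u) (∫ u in (0 : ℝ)..1, φ' x u) x := by
  have sec : ∀ y ∈ K, ContinuousOn (fun u : ℝ => (y, u)) (Icc (0 : ℝ) 1) := fun y _ => by fun_prop
  have secm : ∀ y ∈ K, MapsTo (fun u : ℝ => (y, u)) (Icc (0 : ℝ) 1) (K ×ˢ Icc (0 : ℝ) 1) :=
    fun y hy u hu => ⟨hy, hu⟩
  have hxK : x ∈ K := mem_of_mem_nhds hKn
  obtain ⟨M, hM⟩ := (hK.prod isCompact_Icc).exists_bound_of_continuousOn c2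
  have i1 : ∀ y ∈ K, IntervalIntegrable (φ y) MeasureTheory.volume 0 1 := fun y hy => by
    apply ContinuousOn.intervalIntegrable
    rw [uIcc_of_le zero_le_one]
    exact c1.comp (sec y hy) (secm y hy)
  have i2 : IntervalIntegrable (φ' x) MeasureTheory.volume 0 1 := by
    apply ContinuousOn.intervalIntegrable
    rw [uIcc_of_le zero_le_one]
    exact c2.comp (sec x hxK) (secm x hxK)
  have hI : ∀ u ∈ uIoc (0 : ℝ) 1, u ∈ Icc (0 : ℝ) 1 := fun u hu => by
    rw [uIoc_of_le zero_le_one] at hu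
    exact ⟨hu.1.le, hu.2⟩
  refine ⟨i2, ?_⟩
  refine (intervalIntegral.hasDerivAt_integral_of_dominated_loc_of_deriv_le (bound := fun _ => M)
    (F' := φ') hKn ?_ (i1 x hxK) ?_ ?_ ?_ ?_).2
  · filter_upwards [hKn] with y hy
    exact (intervalIntegrable_iff.1 (i1 y hy)).aestronglyMeasurable
  · exact (intervalIntegrable_iff.1 i2).aestronglyMeasurable
  · exact Eventually.of_forall fun u hu y hy => hM (y, u) ⟨hy, hI u hu⟩
  · exact intervalIntegrable_const
  · exact Eventually.of_forall fun u hu y hy => hd y hy u (hI u hu)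

open Set Metric Topology in
/-- Differentiation under the integral sign for the integrands that occur below. -/
theorem conv_hasDerivAt {Sf Sg : Finset ℂ} {f g : ℂ → ℂ}
    (hf : DifferentiableOn ℂ f ((Sf : Set ℂ))ᶜ) (hg : DifferentiableOn ℂ g ((Sg : Set ℂ))ᶜ)
    {a₀ a₁ b₀ b₁ k₀ k₁ : ℝ → ℂ} (ha₀ : Continuous a₀) (ha₁ : Continuous a₁)
    (hb₀ : Continuous b₀) (hb₁ : Continuous b₁) (hk₀ : Continuous k₀) (hk₁ : Continuous k₁)
    {V : Set ℂ} (hV : IsOpen V)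
    (hA : ∀ x ∈ V, ∀ u ∈ Icc (0 : ℝ) 1, a₀ u + x * a₁ u ∉ Sf)
    (hB : ∀ x ∈ V, ∀ u ∈ Icc (0 : ℝ) 1, b₀ u + x * b₁ u ∉ Sg) {x : ℂ} (hx : x ∈ V) :
    IntervalIntegrable (fun u => (deriv f (a₀ u + x * a₁ u) * a₁ u * g (b₀ u + x * b₁ u) +
        f (a₀ u + x * a₁ u) * (deriv g (b₀ u + x * b₁ u) * b₁ u)) * (k₀ u + x * k₁ u) +
        f (a₀ u + x * a₁ u) * g (b₀ u + x * b₁ u) * k₁ u) MeasureTheory.volume 0 1 ∧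
    HasDerivAt (fun x => ∫ u in (0 : ℝ)..1,
      f (a₀ u + x * a₁ u) * g (b₀ u + x * b₁ u) * (k₀ u + x * k₁ u))
      (∫ u in (0 : ℝ)..1,
        ((deriv f (a₀ u + x * a₁ u) * a₁ u * g (b₀ u + x * b₁ u) +
        f (a₀ u + x * a₁ u) * (deriv g (b₀ u + x * b₁ u) * b₁ u)) * (k₀ u + x * k₁ u) +
        f (a₀ u + x * a₁ u) * g (b₀ u + x * b₁ u) * k₁ u)) x := by
  have hSf : IsOpen ((Sf : Set ℂ))ᶜ := Sf.finite_toSet.isClosed.isOpen_compl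
  have hSg : IsOpen ((Sg : Set ℂ))ᶜ := Sg.finite_toSet.isClosed.isOpen_compl
  have hf' := (hf.deriv hSf).continuousOn
  have hg' := (hg.deriv hSg).continuousOn
  have hfc := hf.continuousOn
  have hgc := hg.continuousOn
  obtain ⟨ρ, hρ, hρV⟩ := Metric.isOpen_iff.1 hV x hx
  set K : Set ℂ := closedBall x (ρ / 2) with hK
  have hKV : K ⊆ V := (closedBall_subset_ball (by linarith)).trans hρV
  have hKn : K ∈ 𝓝 x := closedBall_mem_nhds x (by linarith)
  have mA : MapsTo (fun p : ℂ × ℝ => a₀ p.2 + p.1 * a₁ p.2) (K ×ˢ Icc (0 : ℝ) 1)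
      ((Sf : Set ℂ))ᶜ := fun p hp => hA _ (hKV hp.1) _ hp.2
  have mB : MapsTo (fun p : ℂ × ℝ => b₀ p.2 + p.1 * b₁ p.2) (K ×ˢ Icc (0 : ℝ) 1)
      ((Sg : Set ℂ))ᶜ := fun p hp => hB _ (hKV hp.1) _ hp.2
  have cA : ContinuousOn (fun p : ℂ × ℝ => a₀ p.2 + p.1 * a₁ p.2) (K ×ˢ Icc (0 : ℝ) 1) := by
    fun_prop
  have cB : ContinuousOn (fun p : ℂ × ℝ => b₀ p.2 + p.1 * b₁ p.2) (K ×ˢ Icc (0 : ℝ) 1) := by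
    fun_prop
  have cC : ContinuousOn (fun p : ℂ × ℝ => k₀ p.2 + p.1 * k₁ p.2) (K ×ˢ Icc (0 : ℝ) 1) := by
    fun_prop
  have ca : ContinuousOn (fun p : ℂ × ℝ => a₁ p.2) (K ×ˢ Icc (0 : ℝ) 1) := by fun_prop
  have cb : ContinuousOn (fun p : ℂ × ℝ => b₁ p.2) (K ×ˢ Icc (0 : ℝ) 1) := by fun_prop
  have ck : ContinuousOn (fun p : ℂ × ℝ => k₁ p.2) (K ×ˢ Icc (0 : ℝ) 1) := by fun_prop
  have c1 : ContinuousOn (fun p : ℂ × ℝ => f (a₀ p.2 + p.1 * a₁ p.2) *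
      g (b₀ p.2 + p.1 * b₁ p.2) * (k₀ p.2 + p.1 * k₁ p.2)) (K ×ˢ Icc (0 : ℝ) 1) :=
    ((hfc.comp cA mA).mul (hgc.comp cB mB)).mul cC
  have c2 : ContinuousOn (fun p : ℂ × ℝ =>
      (deriv f (a₀ p.2 + p.1 * a₁ p.2) * a₁ p.2 * g (b₀ p.2 + p.1 * b₁ p.2) +
        f (a₀ p.2 + p.1 * a₁ p.2) * (deriv g (b₀ p.2 + p.1 * b₁ p.2) * b₁ p.2)) *
        (k₀ p.2 + p.1 * k₁ p.2) +
        f (a₀ p.2 + p.1 * a₁ p.2) * g (b₀ p.2 + p.1 * b₁ p.2) * k₁ p.2)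
        (K ×ˢ Icc (0 : ℝ) 1) :=
    (((((hf'.comp cA mA).mul ca).mul (hgc.comp cB mB)).add
      ((hfc.comp cA mA).mul ((hg'.comp cB mB).mul cb))).mul cC).add
      (((hfc.comp cA mA).mul (hgc.comp cB mB)).mul ck)
  refine param_hasDerivAt (φ := fun x u => f (a₀ u + x * a₁ u) * g (b₀ u + x * b₁ u) *
      (k₀ u + x * k₁ u))
    (φ' := fun x u => (deriv f (a₀ u + x * a₁ u) * a₁ u * g (b₀ u + x * b₁ u) +
        f (a₀ u + x * a₁ u) * (deriv g (b₀ u + x * b₁ u) * b₁ u)) * (k₀ u + x * k₁ u) +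
        f (a₀ u + x * a₁ u) * g (b₀ u + x * b₁ u) * k₁ u)
    (isCompact_closedBall x (ρ / 2)) hKn c1 c2 fun y hy u hu => ?_
  have dA : HasDerivAt (fun y : ℂ => a₀ u + y * a₁ u) (a₁ u) y := by
    simpa using ((hasDerivAt_id y).mul_const (a₁ u)).const_add (a₀ u)
  have dB : HasDerivAt (fun y : ℂ => b₀ u + y * b₁ u) (b₁ u) y := by
    simpa using ((hasDerivAt_id y).mul_const (b₁ u)).const_add (b₀ u)
  have dC : HasDerivAt (fun y : ℂ => k₀ u + y * k₁ u) (k₁ u) y := by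
    simpa using ((hasDerivAt_id y).mul_const (k₁ u)).const_add (k₀ u)
  have df := (hf.differentiableAt (hSf.mem_nhds (hA y (hKV hy) u hu))).hasDerivAt
  have dg := (hg.differentiableAt (hSg.mem_nhds (hB y (hKV hy) u hu))).hasDerivAt
  exact ((df.comp y dA).mul (dg.comp y dB)).mul dC

/-- The convolution integral along the deformed contour `c + (z - ξ) e`. -/
noncomputable def convJ (f g : ℂ → ℂ) (c e : ℝ → ℂ) (ξ z : ℂ) : ℂ :=
  ∫ u in (0 : ℝ)..1, f (c u + (z - ξ) * e u) * g (z - (c u + (z - ξ) * e u)) *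
    (deriv c u + (z - ξ) * deriv e u)

open Set Metric Topology in
theorem convJ_differentiableOn {Sf Sg : Finset ℂ} {f g : ℂ → ℂ}
    (hf : DifferentiableOn ℂ f ((Sf : Set ℂ))ᶜ) (hg : DifferentiableOn ℂ g ((Sg : Set ℂ))ᶜ)
    {c e : ℝ → ℂ} (hc : ContDiff ℝ 1 c) (he : ContDiff ℝ 1 e) {ξ : ℂ}
    {V : Set ℂ} (hV : IsOpen V)
    (hA : ∀ z ∈ V, ∀ u ∈ Icc (0 : ℝ) 1, c u + (z - ξ) * e u ∉ Sf)
    (hB : ∀ z ∈ V, ∀ u ∈ Icc (0 : ℝ) 1, z - (c u + (z - ξ) * e u) ∉ Sg) :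
    DifferentiableOn ℂ (convJ f g c e ξ) V := by
  have hc0 := hc.continuous
  have he0 := he.continuous
  have hc1 : Continuous (deriv c) := hc.continuous_deriv le_rfl
  have he1 : Continuous (deriv e) := he.continuous_deriv le_rfl
  intro x hx
  have h := (conv_hasDerivAt hf hg (a₀ := fun u => c u - ξ * e u) (a₁ := e)
    (b₀ := fun u => - (c u - ξ * e u)) (b₁ := fun u => 1 - e u)
    (k₀ := fun u => deriv c u - ξ * deriv e u) (k₁ := deriv e)
    (by fun_prop) (by fun_prop) (by fun_prop) (by fun_prop) (by fun_prop) (by fun_prop)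
    hV (fun z hz u hu => by
      have := hA z hz u hu
      rwa [show c u - ξ * e u + z * e u = c u + (z - ξ) * e u by ring])
    (fun z hz u hu => by
      have := hB z hz u hu
      rwa [show - (c u - ξ * e u) + z * (1 - e u) = z - (c u + (z - ξ) * e u) by ring]) hx).2
  refine (h.differentiableAt.congr_of_eventuallyEq (Eventually.of_forall fun z => ?_)).differentiableWithinAt
  unfold convJ
  congr 1
  ext u
  rw [show c u - ξ * e u + z * e u = c u + (z - ξ) * e u by ring,
    show - (c u - ξ * e u) + z * (1 - e u) = z - (c u + (z - ξ) * e u) by ring,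
    show deriv c u - ξ * deriv e u + z * deriv e u = deriv c u + (z - ξ) * deriv e u by ring]

open Set Metric Topology in
/-- Invariance of the integral under a homotopy fixing the end points. -/
theorem conv_homotopy {Sf Sg : Finset ℂ} {f g : ℂ → ℂ}
    (hf : DifferentiableOn ℂ f ((Sf : Set ℂ))ᶜ) (hg : DifferentiableOn ℂ g ((Sg : Set ℂ))ᶜ)
    {c v : ℝ → ℂ} (hc : ContDiff ℝ 1 c) (hv : ContDiff ℝ 1 v) (hv0 : v 0 = 0) (hv1 : v 1 = 0)
    {z : ℂ}
    (hA : ∀ x ∈ ball (0 : ℂ) 2, ∀ u ∈ Icc (0 : ℝ) 1, c u + x * v u ∉ Sf)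
    (hB : ∀ x ∈ ball (0 : ℂ) 2, ∀ u ∈ Icc (0 : ℝ) 1, z - (c u + x * v u) ∉ Sg) :
    ∫ u in (0 : ℝ)..1, f (c u + v u) * g (z - (c u + v u)) * (deriv c u + deriv v u) =
    ∫ u in (0 : ℝ)..1, f (c u) * g (z - c u) * deriv c u := by
  have hSf : IsOpen ((Sf : Set ℂ))ᶜ := Sf.finite_toSet.isClosed.isOpen_compl
  have hSg : IsOpen ((Sg : Set ℂ))ᶜ := Sg.finite_toSet.isClosed.isOpen_compl
  have hc0 := hc.continuous
  have hv0' := hv.continuous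
  have hc1 : Continuous (deriv c) := hc.continuous_deriv le_rfl
  have hv1' : Continuous (deriv v) := hv.continuous_deriv le_rfl
  have e1 : ∀ (x : ℂ) (u : ℝ), (z - c u) + x * (- v u) = z - (c u + x * v u) := fun x u => by ring
  have key : ∀ x ∈ ball (0 : ℂ) 2, HasDerivAt (fun x => ∫ u in (0 : ℝ)..1,
      f (c u + x * v u) * g ((z - c u) + x * (- v u)) * (deriv c u + x * deriv v u)) 0 x := by
    intro x hx
    obtain ⟨hi, h⟩ := conv_hasDerivAt hf hg (a₀ := c) (a₁ := v)
      (b₀ := fun u => z - c u) (b₁ := fun u => - v u)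
      (k₀ := deriv c) (k₁ := deriv v)
      (by fun_prop) (by fun_prop) (by fun_prop) (by fun_prop) (by fun_prop) (by fun_prop)
      isOpen_ball hA (fun x hx u hu => by rw [e1]; exact hB x hx u hu) hx
    convert h using 1
    symm
    rw [intervalIntegral.integral_eq_sub_of_hasDerivAt
      (f := fun u => f (c u + x * v u) * g ((z - c u) + x * (- v u)) * v u) _ hi]
    · simp [hv0, hv1]
    · intro u hu
      rw [uIcc_of_le zero_le_one] at hu
      have dc : HasDerivAt c (deriv c u) u := (hc.differentiable one_ne_zero u).hasDerivAt
      have dv : HasDerivAt v (deriv v u) u := (hv.differentiable one_ne_zero u).hasDerivAt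
      have dA : HasDerivAt (fun u => c u + x * v u) (deriv c u + x * deriv v u) u :=
        dc.add (dv.const_mul x)
      have dB : HasDerivAt (fun u => (z - c u) + x * (- v u))
          (- deriv c u + x * (- deriv v u)) u :=
        (dc.const_sub z).add (dv.neg.const_mul x)
      have df := (hf.differentiableAt (hSf.mem_nhds (hA x hx u hu))).hasDerivAt
      have hB' := hB x hx u hu
      rw [← e1] at hB'
      have dg := (hg.differentiableAt (hSg.mem_nhds hB')).hasDerivAt
      have := ((df.comp u dA).mul (dg.comp u dB)).mul dv
      refine this.congr_deriv ?_
      simp only [Pi.mul_apply, Function.comp_apply]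
      ring
  have hconst := isOpen_ball.is_const_of_deriv_eq_zero (convex_ball (0 : ℂ) 2).isPreconnected
    (fun x hx => (key x hx).differentiableAt.differentiableWithinAt)
    (fun x hx => (key x hx).deriv) (x := 1) (y := 0) (by simp) (by simp)
  simpa [sub_sub, sub_eq_add_neg, add_assoc, add_comm, add_left_comm] using hconst

open Set Metric Topology in
theorem exists_sep {S : Set ℂ} (hS : IsClosed S) {T : Set ℝ} (hT : IsCompact T) {φ : ℝ → ℂ}
    (hφ : ContinuousOn φ T) (h : ∀ t ∈ T, φ t ∉ S) :
    ∃ ρ > 0, ∀ t ∈ T, ∀ a ∈ S, ρ ≤ ‖φ t - a‖ := by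
  obtain ⟨ρ, hρ, hsub⟩ := (hT.image_of_continuousOn hφ).exists_thickening_subset_open
    hS.isOpen_compl (by rintro _ ⟨t, ht, rfl⟩; exact h t ht)
  refine ⟨ρ, hρ, fun t ht a ha => ?_⟩
  by_contra hlt
  push Not at hlt
  refine hsub (mem_thickening_iff.2 ⟨φ t, ⟨t, ht, rfl⟩, ?_⟩) ha
  rwa [dist_comm, dist_eq_norm]

/-- Admissible integration contours from `0` to `ξ`. -/
def GoodPath (Sf Sg : Finset ℂ) (ξ : ℂ) (c : ℝ → ℂ) : Prop :=
  ContDiff ℝ 1 c ∧ c 0 = 0 ∧ c 1 = ξ ∧ ∀ u ∈ Set.Icc (0 : ℝ) 1, c u ∉ Sf ∧ ξ - c u ∉ Sg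

/-- Admissible deformation weights. -/
def GoodWeight (e : ℝ → ℂ) : Prop :=
  ContDiff ℝ 1 e ∧ e 0 = 0 ∧ e 1 = 1 ∧ ∀ u ∈ Set.Icc (0 : ℝ) 1, ‖e u‖ ≤ 1 ∧ ‖1 - e u‖ ≤ 1

theorem goodWeight_id : GoodWeight (fun u : ℝ => (u : ℂ)) := by
  refine ⟨Complex.ofRealCLM.contDiff, by simp, by simp, fun u hu => ⟨?_, ?_⟩⟩
  · rw [Complex.norm_real, Real.norm_eq_abs, abs_le]
    constructor <;> linarith [hu.1, hu.2]
  · rw [← Complex.ofReal_one, ← Complex.ofReal_sub, Complex.norm_real, Real.norm_eq_abs, abs_le]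
    constructor <;> linarith [hu.1, hu.2]

open Set Metric Topology in
theorem convJ_weight_indep {Sf Sg : Finset ℂ} {f g : ℂ → ℂ}
    (hf : DifferentiableOn ℂ f ((Sf : Set ℂ))ᶜ) (hg : DifferentiableOn ℂ g ((Sg : Set ℂ))ᶜ)
    {ξ : ℂ} {c e₁ e₂ : ℝ → ℂ} (hc : GoodPath Sf Sg ξ c) (h₁ : GoodWeight e₁)
    (h₂ : GoodWeight e₂) :
    ∀ᶠ z in 𝓝 ξ, convJ f g c e₁ ξ z = convJ f g c e₂ ξ z := by
  obtain ⟨hcd, hc0, hc1, hcg⟩ := hc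
  obtain ⟨h1d, h10, h11, h1b⟩ := h₁
  obtain ⟨h2d, h20, h21, h2b⟩ := h₂
  have hcc := hcd.continuous
  obtain ⟨ρ, hρ, hsep⟩ := exists_sep Sf.finite_toSet.isClosed isCompact_Icc
    (φ := c) hcc.continuousOn (fun u hu => (hcg u hu).1)
  obtain ⟨ρ', hρ', hsep'⟩ := exists_sep Sg.finite_toSet.isClosed isCompact_Icc
    (φ := fun u => ξ - c u) (by fun_prop) (fun u hu => (hcg u hu).2)
  have hm : 0 < min ρ ρ' / 8 := by positivity
  filter_upwards [ball_mem_nhds ξ hm] with z hz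
  rw [mem_ball, dist_eq_norm] at hz
  have hz1 : ‖z - ξ‖ * 8 < ρ := by linarith [min_le_left ρ ρ']
  have hz2 : ‖z - ξ‖ * 8 < ρ' := by linarith [min_le_right ρ ρ']
  have hcomb : ∀ x ∈ ball (0 : ℂ) 2, ∀ u ∈ Icc (0 : ℝ) 1, ‖e₁ u + x * (e₂ u - e₁ u)‖ ≤ 5 := by
    intro x hx u hu
    rw [mem_ball_zero_iff] at hx
    calc ‖e₁ u + x * (e₂ u - e₁ u)‖ ≤ ‖e₁ u‖ + ‖x‖ * (‖e₂ u‖ + ‖e₁ u‖) := by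
          refine (norm_add_le _ _).trans ?_
          rw [norm_mul]
          gcongr
          exact norm_sub_le _ _
      _ ≤ 1 + 2 * (1 + 1) := by
          gcongr
          exacts [(h1b u hu).1, (h2b u hu).1, (h1b u hu).1]
      _ = 5 := by norm_num
  have hd1 : ∀ u, HasDerivAt c (deriv c u) u := fun u =>
    (hcd.differentiable one_ne_zero u).hasDerivAt
  have hd2 : ∀ u, HasDerivAt e₁ (deriv e₁ u) u := fun u =>
    (h1d.differentiable one_ne_zero u).hasDerivAt
  have hd3 : ∀ u, HasDerivAt e₂ (deriv e₂ u) u := fun u =>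
    (h2d.differentiable one_ne_zero u).hasDerivAt
  have D1 : ∀ u, deriv (fun u => c u + (z - ξ) * e₁ u) u = deriv c u + (z - ξ) * deriv e₁ u :=
    fun u => ((hd1 u).add ((hd2 u).const_mul (z - ξ))).deriv
  have D2 : ∀ u, deriv (fun u => (z - ξ) * (e₂ u - e₁ u)) u =
      (z - ξ) * (deriv e₂ u - deriv e₁ u) :=
    fun u => (((hd3 u).sub (hd2 u)).const_mul (z - ξ)).deriv
  have hE : ∀ (x : ℂ) (u : ℝ), c u + (z - ξ) * e₁ u + x * ((z - ξ) * (e₂ u - e₁ u)) =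
      c u + (z - ξ) * (e₁ u + x * (e₂ u - e₁ u)) := fun x u => by ring
  have H := conv_homotopy hf hg (c := fun u => c u + (z - ξ) * e₁ u)
    (v := fun u => (z - ξ) * (e₂ u - e₁ u)) (z := z)
    (by fun_prop) (by fun_prop) (by simp [h10, h20]) (by simp [h11, h21])
    (fun x hx u hu hmem => by
      rw [hE] at hmem
      have h := hsep u hu _ hmem
      rw [sub_add_cancel_left, norm_neg, norm_mul] at h
      nlinarith [hcomb x hx u hu, norm_nonneg (z - ξ)])
    (fun x hx u hu hmem => by
      rw [hE] at hmem
      have h := hsep' u hu _ hmem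
      rw [show ξ - c u - (z - (c u + (z - ξ) * (e₁ u + x * (e₂ u - e₁ u)))) =
        (z - ξ) * ((e₁ u + x * (e₂ u - e₁ u)) - 1) by ring, norm_mul] at h
      have h6 : ‖(e₁ u + x * (e₂ u - e₁ u)) - 1‖ ≤ 6 := by
        refine (norm_sub_le _ _).trans ?_
        rw [norm_one]
        linarith [hcomb x hx u hu]
      nlinarith [norm_nonneg (z - ξ)])
  simp only [D1, D2] at H
  unfold convJ
  rw [← H]
  congr 1
  ext u
  rw [show c u + (z - ξ) * e₁ u + (z - ξ) * (e₂ u - e₁ u) = c u + (z - ξ) * e₂ u by ring,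
    show deriv c u + (z - ξ) * deriv e₁ u + (z - ξ) * (deriv e₂ u - deriv e₁ u) =
      deriv c u + (z - ξ) * deriv e₂ u by ring]

open Set Metric Topology in
/-- Moving the base point of the deformation. -/
theorem convJ_rebase {f g : ℂ → ℂ} {c e : ℝ → ℂ} (hc : ContDiff ℝ 1 c) (he : ContDiff ℝ 1 e)
    (ξ ξ' z : ℂ) :
    convJ f g (fun u => c u + (ξ' - ξ) * e u) e ξ' z = convJ f g c e ξ z := by
  have D1 : ∀ u, deriv (fun u => c u + (ξ' - ξ) * e u) u = deriv c u + (ξ' - ξ) * deriv e u :=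
    fun u => ((hc.differentiable one_ne_zero u).hasDerivAt.add
      ((he.differentiable one_ne_zero u).hasDerivAt.const_mul (ξ' - ξ))).deriv
  unfold convJ
  simp only [D1]
  congr 1
  ext u
  rw [show c u + (ξ' - ξ) * e u + (z - ξ') * e u = c u + (z - ξ) * e u by ring,
    show deriv c u + (ξ' - ξ) * deriv e u + (z - ξ') * deriv e u =
      deriv c u + (z - ξ) * deriv e u by ring]

open Set Metric Topology in
theorem exists_weight {Sf Sg : Finset ℂ} {ξ : ℂ} {c : ℝ → ℂ} (hc : GoodPath Sf Sg ξ c)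
    {r : ℝ} (hr : 0 < r) (h1 : ∀ a ∈ Sf, 2 * r < ‖ξ - a‖) (h2 : ∀ a ∈ Sg, 2 * r < ‖ξ - a‖)
    (h3 : ∀ a ∈ Sf, ∀ b ∈ Sg, 2 * r < ‖ξ - (a + b)‖) :
    ∃ e, GoodWeight e ∧ ∀ z ∈ ball ξ r, ∀ u ∈ Icc (0 : ℝ) 1,
      c u + (z - ξ) * e u ∉ Sf ∧ z - (c u + (z - ξ) * e u) ∉ Sg := by
  obtain ⟨hcd, hc0, hc1, hcg⟩ := hc
  have hcc := hcd.continuous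
  have hA : IsClosed ((⋃ a ∈ Sf, {u : ℝ | ‖c u - a‖ ≤ r}) ∪ {0}) :=
    (Sf.finite_toSet.isClosed_biUnion fun a _ => isClosed_le (by fun_prop) (by fun_prop)).union
      isClosed_singleton
  have hB : IsClosed ((⋃ b ∈ Sg, {u : ℝ | ‖ξ - c u - b‖ ≤ r}) ∪ {1}) :=
    (Sg.finite_toSet.isClosed_biUnion fun a _ => isClosed_le (by fun_prop) (by fun_prop)).union
      isClosed_singleton
  have hd : Disjoint ((⋃ a ∈ Sf, {u : ℝ | ‖c u - a‖ ≤ r}) ∪ {0})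
      ((⋃ b ∈ Sg, {u : ℝ | ‖ξ - c u - b‖ ≤ r}) ∪ {1}) := by
    rw [Set.disjoint_left]
    rintro u (hu | hu) (hu' | hu')
    · simp only [mem_iUnion, mem_ofPred_eq, exists_prop] at hu hu'
      obtain ⟨a, ha, hu⟩ := hu
      obtain ⟨b, hb, hu'⟩ := hu'
      have := norm_add_le (c u - a) (ξ - c u - b)
      rw [show c u - a + (ξ - c u - b) = ξ - (a + b) by ring] at this
      linarith [h3 a ha b hb]
    · simp only [mem_iUnion, mem_ofPred_eq, exists_prop] at hu
      obtain ⟨a, ha, hu⟩ := hu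
      rw [mem_singleton_iff.1 hu', hc1] at hu
      linarith [h1 a ha]
    · simp only [mem_iUnion, mem_ofPred_eq, exists_prop] at hu'
      obtain ⟨b, hb, hu'⟩ := hu'
      rw [mem_singleton_iff.1 hu, hc0, sub_zero] at hu'
      linarith [h2 b hb]
    · rw [mem_singleton_iff] at hu hu'
      linarith
  obtain ⟨η, hη0, hη1, hηI⟩ := exists_contMDiffMap_zero_one_of_isClosed (n := 1)
    (modelWithCornersSelf ℝ ℝ) hA hB hd
  have hηd : ContDiff ℝ 1 η := η.contMDiff.contDiff
  have hb1 : ∀ u, ‖((η u : ℝ) : ℂ)‖ ≤ 1 := fun u => by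
    rw [Complex.norm_real, Real.norm_eq_abs, abs_le]
    constructor <;> linarith [(hηI u).1, (hηI u).2]
  have hb2 : ∀ u, ‖1 - ((η u : ℝ) : ℂ)‖ ≤ 1 := fun u => by
    rw [← Complex.ofReal_one, ← Complex.ofReal_sub, Complex.norm_real, Real.norm_eq_abs, abs_le]
    constructor <;> linarith [(hηI u).1, (hηI u).2]
  refine ⟨fun u => ((η u : ℝ) : ℂ), ⟨Complex.ofRealCLM.contDiff.comp hηd, ?_, ?_,
    fun u _ => ⟨hb1 u, hb2 u⟩⟩, fun z hz u hu => ⟨fun hmem => ?_, fun hmem => ?_⟩⟩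
  · simp [hη0 (show (0 : ℝ) ∈ _ from Or.inr rfl)]
  · simp [hη1 (show (1 : ℝ) ∈ _ from Or.inr rfl)]
  · rw [mem_ball, dist_eq_norm] at hz
    have hu0 : u ∈ (⋃ a ∈ Sf, {u : ℝ | ‖c u - a‖ ≤ r}) ∪ {0} := by
      refine Or.inl (mem_biUnion (show _ ∈ (Sf : Set ℂ) from hmem) ?_)
      rw [mem_ofPred_eq, sub_add_cancel_left, norm_neg, norm_mul]
      nlinarith [hb1 u, norm_nonneg (z - ξ)]
    have := hη0 hu0
    simp only [Pi.zero_apply] at this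
    simp only [this] at hmem
    exact (hcg u hu).1 (by simpa using hmem)
  · rw [mem_ball, dist_eq_norm] at hz
    have hu0 : u ∈ (⋃ b ∈ Sg, {u : ℝ | ‖ξ - c u - b‖ ≤ r}) ∪ {1} := by
      refine Or.inl (mem_biUnion (show _ ∈ (Sg : Set ℂ) from hmem) ?_)
      rw [mem_ofPred_eq, show ξ - c u - (z - (c u + (z - ξ) * ((η u : ℝ) : ℂ))) =
        - ((z - ξ) * (1 - ((η u : ℝ) : ℂ))) by ring, norm_neg, norm_mul]
      nlinarith [hb2 u, norm_nonneg (z - ξ)]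
    have := hη1 hu0
    simp only [Pi.one_apply] at this
    simp only [this] at hmem
    refine (hcg u hu).2 ?_
    rw [show ξ - c u = z - (c u + (z - ξ) * ((1 : ℝ) : ℂ)) by push_cast; ring]
    exact hmem

/-- Continuation along `γ` up to time `t`, ending in a germ given by an admissible contour. -/
def ACto (Sf Sg : Finset ℂ) (f g h : ℂ → ℂ) (γ : ℝ → ℂ) (t : ℝ) : Prop :=
  ∃ (U : ℝ → Set ℂ) (F : ℝ → ℂ → ℂ),
    (∀ s ∈ Set.Icc (0 : ℝ) t, IsOpen (U s) ∧ γ s ∈ U s ∧ DifferentiableOn ℂ (F s) (U s)) ∧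
    (∀ s ∈ Set.Icc (0 : ℝ) t, ∃ ε > (0 : ℝ), ∀ s' ∈ Set.Icc (0 : ℝ) t, |s' - s| < ε →
      γ s' ∈ U s ∧ ∀ᶠ z in nhds (γ s'), F s' z = F s z) ∧
    (∀ᶠ z in nhds (γ 0), F 0 z = h z) ∧
    ∃ c, GoodPath Sf Sg (γ t) c ∧
      ∀ᶠ z in nhds (γ t), F t z = convJ f g c (fun u : ℝ => (u : ℂ)) (γ t) z

theorem goodPath_move {Sf Sg : Finset ℂ} {ξ ξ' : ℂ} {c e : ℝ → ℂ} (hc : GoodPath Sf Sg ξ c)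
    (he : GoodWeight e) (h : ∀ u ∈ Set.Icc (0 : ℝ) 1,
      c u + (ξ' - ξ) * e u ∉ Sf ∧ ξ' - (c u + (ξ' - ξ) * e u) ∉ Sg) :
    GoodPath Sf Sg ξ' (fun u => c u + (ξ' - ξ) * e u) := by
  obtain ⟨hcd, hc0, hc1, -⟩ := hc
  obtain ⟨hed, he0, he1, -⟩ := he
  exact ⟨by fun_prop, by simp [hc0, he0], by simp [hc1, he1], h⟩

open Set Metric Topology in
theorem ACto_step {Sf Sg : Finset ℂ} {f g h : ℂ → ℂ}
    (hf : DifferentiableOn ℂ f ((Sf : Set ℂ))ᶜ) (hg : DifferentiableOn ℂ g ((Sg : Set ℂ))ᶜ)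
    {γ : ℝ → ℂ} (hγ : ContinuousOn γ (Icc 0 1)) {t t' : ℝ} (ht0 : 0 ≤ t) (htt : t ≤ t')
    (ht1 : t' ≤ 1) {r : ℝ} (hr : 0 < r) (h1 : ∀ a ∈ Sf, 2 * r < ‖γ t - a‖)
    (h2 : ∀ a ∈ Sg, 2 * r < ‖γ t - a‖)
    (h3 : ∀ a ∈ Sf, ∀ b ∈ Sg, 2 * r < ‖γ t - (a + b)‖)
    (hball : ∀ s ∈ Icc t t', γ s ∈ ball (γ t) r)
    (H : ACto Sf Sg f g h γ t) : ACto Sf Sg f g h γ t' := by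
  obtain ⟨U, F, hU, hcons, hinit, c, hc, hgerm⟩ := H
  obtain ⟨e, he, hav⟩ := exists_weight hc hr h1 h2 h3
  set G := convJ f g c e (γ t) with hG
  have hGd : DifferentiableOn ℂ G (ball (γ t) r) :=
    convJ_differentiableOn hf hg hc.1 he.1 isOpen_ball (fun z hz u hu => (hav z hz u hu).1)
      (fun z hz u hu => (hav z hz u hu).2)
  have hFG : ∀ᶠ z in 𝓝 (γ t), F t z = G z := by
    filter_upwards [hgerm, convJ_weight_indep hf hg hc goodWeight_id he] with z a b
    rw [a, b]
  have hc' := goodPath_move hc he (hav (γ t') (hball t' ⟨htt, le_rfl⟩))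
  have hG' : ∀ᶠ z in 𝓝 (γ t'), G z = convJ f g (fun u => c u + (γ t' - γ t) * e u)
      (fun u : ℝ => (u : ℂ)) (γ t') z := by
    filter_upwards [convJ_weight_indep hf hg hc' he goodWeight_id] with z a
    rw [← a, convJ_rebase hc.1 he.1]
  refine ⟨fun s => if s ≤ t then U s else ball (γ t) r, fun s => if s ≤ t then F s else G,
    ?_, ?_, ?_, _, hc', ?_⟩
  · intro s hs
    by_cases hst : s ≤ t
    · simpa [hst] using hU s ⟨hs.1, hst⟩
    · simp only [hst, if_false]
      exact ⟨isOpen_ball, hball s ⟨(not_le.1 hst).le, hs.2⟩, hGd⟩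
  · intro s hs
    by_cases hst : s ≤ t
    · simp only [hst, if_true]
      obtain ⟨ε, hε, hεs⟩ := hcons s ⟨hs.1, hst⟩
      rcases hst.lt_or_eq with hlt | rfl
      · refine ⟨min ε (t - s), lt_min hε (by linarith), fun s' hs' hd => ?_⟩
        have hs't : s' ≤ t := by
          have := (le_abs_self _).trans_lt (hd.trans_le (min_le_right _ _))
          linarith
        simp only [hs't, if_true]
        exact hεs s' ⟨hs'.1, hs't⟩ (hd.trans_le (min_le_left _ _))
      · have hcw : ContinuousWithinAt γ (Icc 0 1) s := hγ s ⟨hs.1, hs.2.trans ht1⟩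
        have hev : ∀ᶠ x in 𝓝 (γ s), x ∈ U s ∧ ∀ᶠ z in 𝓝 x, F s z = G z :=
          ((hU s ⟨hs.1, le_rfl⟩).1.eventually_mem (hU s ⟨hs.1, le_rfl⟩).2.1).and
            hFG.eventually_nhds
        have hev' := hcw.eventually hev
        rw [_root_.eventually_nhdsWithin_iff, Metric.eventually_nhds_iff] at hev'
        obtain ⟨ε', hε', hev'⟩ := hev'
        refine ⟨min ε ε', lt_min hε hε', fun s' hs' hd => ?_⟩
        by_cases hs't : s' ≤ s
        · simp only [hs't, if_true]
          exact hεs s' ⟨hs'.1, hs't⟩ (hd.trans_le (min_le_left _ _))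
        · simp only [hs't, if_false]
          have := hev' (y := s') (by rw [Real.dist_eq]; exact hd.trans_le (min_le_right _ _))
            ⟨hs'.1, hs'.2.trans ht1⟩
          exact ⟨this.1, this.2.mono fun z hz => hz.symm⟩
    · refine ⟨s - t, by linarith [not_le.1 hst], fun s' hs' hd => ?_⟩
      have hs't : ¬ s' ≤ t := by
        have := (neg_abs_le (s' - s))
        intro hle
        linarith
      simp only [hst, hs't, if_false]
      exact ⟨hball s' ⟨(not_le.1 hs't).le, hs'.2⟩, Eventually.of_forall fun z => trivial⟩
  · simpa [ht0] using hinit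
  · by_cases hle : t' ≤ t
    · obtain rfl : t = t' := le_antisymm htt hle
      simp only [le_refl, if_true]
      filter_upwards [hFG, hG'] with z a b
      rw [a, b]
    · simpa only [hle, if_false] using hG'

/-- if `f`, `g` are holomorphic on `ℂ∖Σ_f`, `ℂ∖Σ_g` for finite
sets `Σ_f, Σ_g ⊂ ℂ∖{0}`, then the additive convolution
`(f ⊕ g)(ξ) = ∫_0^ξ f(t)g(ξ−t)dt` extends analytically along every path
starting at `0` that avoids `Σ_f ∪ Σ_g ∪ (Σ_f + Σ_g)`. -/
theorem convolution_endless_continuation (Sf Sg : Finset ℂ)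
    (h0f : (0 : ℂ) ∉ Sf) (h0g : (0 : ℂ) ∉ Sg) (f g : ℂ → ℂ)
    (hf : DifferentiableOn ℂ f ((Sf : Set ℂ))ᶜ)
    (hg : DifferentiableOn ℂ g ((Sg : Set ℂ))ᶜ)
    (γ : ℝ → ℂ) (hγc : ContinuousOn γ (Set.Icc 0 1)) (hγ0 : γ 0 = 0)
    (hγ : ∀ s ∈ Set.Ioc (0 : ℝ) 1,
      γ s ∉ (Sf : Set ℂ) ∪ (Sg : Set ℂ) ∪ ((Sf : Set ℂ) + (Sg : Set ℂ))) :
    AnalyticContinuationAlong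
      (fun ξ : ℂ => ξ * ∫ s in (0 : ℝ)..1, f ((s : ℂ) * ξ) * g (ξ - (s : ℂ) * ξ)) γ := by
  have hSfc : IsClosed (Sf : Set ℂ) := Sf.finite_toSet.isClosed
  have hSgc : IsClosed (Sg : Set ℂ) := Sg.finite_toSet.isClosed
  set h : ℂ → ℂ := fun ξ : ℂ => ξ * ∫ s in (0 : ℝ)..1, f ((s : ℂ) * ξ) * g (ξ - (s : ℂ) * ξ)
    with hh
  -- initial disc
  have hopen : IsOpen (((Sf : Set ℂ))ᶜ ∩ ((Sg : Set ℂ))ᶜ) :=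
    hSfc.isOpen_compl.inter hSgc.isOpen_compl
  obtain ⟨r₀, hr₀, hr₀s⟩ := Metric.isOpen_iff.1 hopen 0 ⟨by simpa using h0f, by simpa using h0g⟩
  have hgood0 : GoodPath Sf Sg 0 (fun _ => 0) :=
    ⟨contDiff_const, rfl, rfl, fun u _ => ⟨h0f, by simpa using h0g⟩⟩
  have hJ : ∀ z, convJ f g (fun _ => 0) (fun u : ℝ => (u : ℂ)) 0 z = h z := by
    intro z
    have hd : ∀ u : ℝ, deriv (fun u : ℝ => (u : ℂ)) u = 1 := fun u =>
      (Complex.ofRealCLM.hasDerivAt (x := u)).deriv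
    simp only [convJ, hh, hd, deriv_const]
    rw [← intervalIntegral.integral_const_mul]
    congr 1
    ext u
    simp only [zero_add, sub_zero, mul_one]
    rw [mul_comm z (u : ℂ)]
    ring
  have hav0 : ∀ z ∈ Metric.ball (0 : ℂ) r₀, ∀ u ∈ Set.Icc (0 : ℝ) 1,
      (0 : ℂ) + (z - 0) * (u : ℂ) ∉ Sf ∧ z - ((0 : ℂ) + (z - 0) * (u : ℂ)) ∉ Sg := by
    intro z hz u hu
    have hb := goodWeight_id.2.2.2 u hu
    rw [mem_ball_zero_iff] at hz
    constructor
    · refine (hr₀s (mem_ball_zero_iff.2 ?_)).1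
      rw [zero_add, sub_zero, norm_mul]
      nlinarith [hb.1, norm_nonneg z]
    · refine (hr₀s (mem_ball_zero_iff.2 ?_)).2
      rw [show z - ((0 : ℂ) + (z - 0) * (u : ℂ)) = z * (1 - (u : ℂ)) by ring, norm_mul]
      nlinarith [hb.2, norm_nonneg z]
  have hhd : DifferentiableOn ℂ h (Metric.ball 0 r₀) := by
    have := convJ_differentiableOn hf hg (c := fun _ => 0) (e := fun u : ℝ => (u : ℂ)) (ξ := 0)
      contDiff_const goodWeight_id.1 Metric.isOpen_ball
      (fun z hz u hu => (hav0 z hz u hu).1) (fun z hz u hu => (hav0 z hz u hu).2)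
    exact this.congr fun z _ => (hJ z).symm
  obtain ⟨δ, hδ, hδ1, hδb⟩ : ∃ δ > 0, δ ≤ 1 ∧ ∀ s ∈ Set.Icc 0 δ, γ s ∈ Metric.ball (0 : ℂ) r₀ := by
    have hev := (hγc 0 ⟨le_rfl, zero_le_one⟩).eventually (Metric.ball_mem_nhds (γ 0) hr₀)
    rw [_root_.eventually_nhdsWithin_iff, Metric.eventually_nhds_iff] at hev
    obtain ⟨δ, hδ, hev⟩ := hev
    refine ⟨min (δ / 2) 1, by positivity, min_le_right _ _, fun s hs => ?_⟩
    have := hev (y := s) (by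
      rw [Real.dist_eq, sub_zero, abs_of_nonneg hs.1]
      linarith [hs.2, min_le_left (δ / 2) 1]) ⟨hs.1, hs.2.trans (min_le_right _ _)⟩
    rwa [hγ0] at this
  have hbase : ACto Sf Sg f g h γ δ := by
    have hm := goodPath_move hgood0 goodWeight_id (hav0 (γ δ) (hδb δ ⟨hδ.le, le_rfl⟩))
    refine ⟨fun _ => Metric.ball 0 r₀, fun _ => h, fun s hs => ⟨Metric.isOpen_ball, hδb s hs, hhd⟩,
      fun s hs => ⟨1, one_pos, fun s' hs' _ => ⟨hδb s' hs', Eventually.of_forall fun _ => rfl⟩⟩,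
      Eventually.of_forall fun _ => rfl, _, hm, Eventually.of_forall fun z => ?_⟩
    rw [convJ_rebase contDiff_const goodWeight_id.1, hJ]
  -- uniform step size on `[δ, 1]`
  have hSc : IsClosed ((Sf : Set ℂ) ∪ (Sg : Set ℂ) ∪ ((Sf : Set ℂ) + (Sg : Set ℂ))) :=
    ((Sf.finite_toSet.union Sg.finite_toSet).union
      (Sf.finite_toSet.add Sg.finite_toSet)).isClosed
  obtain ⟨ρ, hρ, hsep⟩ := exists_sep hSc (isCompact_Icc (a := δ) (b := 1))
    (hγc.mono (Set.Icc_subset_Icc_left hδ.le)) (fun t ht => hγ t ⟨hδ.trans_le ht.1, ht.2⟩)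
  have huc := isCompact_Icc.uniformContinuousOn_of_continuous hγc
  rw [Metric.uniformContinuousOn_iff] at huc
  obtain ⟨ε, hε, huc⟩ := huc (ρ / 3) (by positivity)
  have hind : ∀ n : ℕ, ACto Sf Sg f g h γ (min 1 (δ + n * (ε / 2))) := by
    intro n
    induction n with
    | zero => simpa [hδ1] using hbase
    | succ n ih =>
      have hlow : δ ≤ min 1 (δ + n * (ε / 2)) := le_min hδ1 (by
        have : 0 ≤ (n : ℝ) * (ε / 2) := by positivity
        linarith)
      have hle : min 1 (δ + n * (ε / 2)) ≤ min 1 (δ + (n + 1 : ℕ) * (ε / 2)) := by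
        refine min_le_min_left _ ?_
        push_cast
        linarith
      have hgap : min 1 (δ + (n + 1 : ℕ) * (ε / 2)) ≤ min 1 (δ + n * (ε / 2)) + ε / 2 := by
        rw [← min_add_add_right]
        refine min_le_min (by linarith) ?_
        push_cast
        linarith
      have hup : min 1 (δ + (n + 1 : ℕ) * (ε / 2)) ≤ 1 := min_le_left _ _
      have hsep' := hsep _ ⟨hlow, min_le_left _ _⟩
      refine ACto_step hf hg hγc (hδ.le.trans hlow) hle hup (r := ρ / 3) (by positivity)
        (fun a ha => ?_) (fun a ha => ?_) (fun a ha b hb => ?_) (fun s hs => ?_) ih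
      · linarith [hsep' a (Or.inl (Or.inl ha))]
      · linarith [hsep' a (Or.inl (Or.inr ha))]
      · linarith [hsep' (a + b) (Or.inr (Set.add_mem_add ha hb))]
      · refine huc s ⟨by linarith [hs.1], hs.2.trans hup⟩ _
          ⟨hδ.le.trans hlow, min_le_left _ _⟩ ?_
        rw [Real.dist_eq, abs_of_nonneg (by linarith [hs.1])]
        linarith [hs.2]
  obtain ⟨n, hn⟩ := exists_nat_gt (1 / (ε / 2))
  have hn' : 1 ≤ δ + n * (ε / 2) := by
    rw [div_lt_iff₀ (by positivity)] at hn
    linarith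
  have hfin := hind n
  rw [min_eq_left hn'] at hfin
  obtain ⟨U, F, hU, hcons, hinit, -⟩ := hfin
  exact ⟨U, F, hU, hcons, hinit⟩
end
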